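/- arXiv:2209.07883 — 3 statements merged into one kernel-verified Lean document; each statement's English description precedes it below -/
import Mathlib

section
/- Let f_1,…,f_n : ℝ^d → ℝ be differentiable with L_i-Lipschitz gradients (L_i > 0), let B ⊆ {1,…,n} be nonempty with L_B = (1/|B|) ∑_{i ∈ B} L_i, let x, s ∈ ℝ^d, and let α ≥ 0. If y ∈ ℝ^d satisfies f_B(y) ≤ min { f_B(x − α s), f_B(x + α s), f_B(x) }, then f_B(y) ≤ f_B(x) − α |⟨∇f_B(x), s⟩| + (L_B / 2) α² ‖s‖², where ∇f_B(x) = (1/|B|) ∑_{i ∈ B} ∇f_i(x) and ⟨·,·⟩ is the Euclidean inner product. -/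
open Finset
open scoped RealInnerProductSpace

/-- The descent lemma: the quadratic upper bound for a function with `L`-Lipschitz gradient. -/
theorem le_add_inner_gradient_add_sq {E : Type*} [NormedAddCommGroup E] [InnerProductSpace ℝ E]
    [CompleteSpace E] {f : E → ℝ} {L : ℝ} (hf : Differentiable ℝ f)
    (hlip : ∀ x y : E, ‖gradient f x - gradient f y‖ ≤ L * ‖x - y‖) (x v : E) :
    f (x + v) ≤ f x + ⟪gradient f x, v⟫ + L / 2 * ‖v‖ ^ 2 := by
  have hline (t : ℝ) : HasDerivAt (fun t : ℝ => f (x + t • v)) ⟪gradient f (x + t • v), v⟫ t := by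
    have hv : HasDerivAt (fun t : ℝ => x + t • v) v t := by
      simpa using ((hasDerivAt_id t).smul_const v).const_add x
    exact (hf (x + t • v)).hasGradientAt.hasFDerivAt.comp_hasDerivAt t hv
  have hquad (t : ℝ) :
      HasDerivAt (fun t : ℝ => f x + t * ⟪gradient f x, v⟫ + L / 2 * ‖v‖ ^ 2 * t ^ 2)
        (⟪gradient f x, v⟫ + L * ‖v‖ ^ 2 * t) t := by
    refine ((((hasDerivAt_id' t).mul_const ⟪gradient f x, v⟫).const_add (f x)).add
      (((hasDerivAt_id' t).pow 2).const_mul (L / 2 * ‖v‖ ^ 2))).congr_deriv ?_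
    simp only [Nat.cast_ofNat]
    ring
  have hbound : ∀ t ∈ Set.Ico (0 : ℝ) 1,
      ⟪gradient f (x + t • v), v⟫ ≤ ⟪gradient f x, v⟫ + L * ‖v‖ ^ 2 * t := by
    intro t ht
    have hgrad : ‖gradient f (x + t • v) - gradient f x‖ ≤ L * (t * ‖v‖) := by
      simpa [norm_smul, abs_of_nonneg ht.1] using hlip (x + t • v) x
    have hinner := real_inner_le_norm (gradient f (x + t • v) - gradient f x) v
    rw [inner_sub_left] at hinner
    nlinarith [mul_le_mul_of_nonneg_right hgrad (norm_nonneg v)]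
  have h := image_le_of_deriv_right_le_deriv_boundary
    (fun t _ => (hline t).continuousAt.continuousWithinAt)
    (fun t _ => (hline t).hasDerivWithinAt) (by simp)
    (fun t _ => (hquad t).continuousAt.continuousWithinAt)
    (fun t _ => (hquad t).hasDerivWithinAt) hbound (Set.right_mem_Icc.2 zero_le_one)
  simpa using h

theorem mistp_one_step_descent (d n : ℕ)
    (f : Fin n → EuclideanSpace ℝ (Fin d) → ℝ) (L : Fin n → ℝ)
    (hdiff : ∀ i, Differentiable ℝ (f i)) (hLpos : ∀ i, 0 < L i)
    (hlip : ∀ i, ∀ x y : EuclideanSpace ℝ (Fin d),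
      ‖gradient (f i) x - gradient (f i) y‖ ≤ L i * ‖x - y‖)
    (B : Finset (Fin n)) (hB : B.Nonempty)
    (x s y : EuclideanSpace ℝ (Fin d)) (α : ℝ) (hα : 0 ≤ α)
    (hy : (1 / (B.card : ℝ)) * ∑ i ∈ B, f i y
      ≤ min ((1 / (B.card : ℝ)) * ∑ i ∈ B, f i (x - α • s))
          (min ((1 / (B.card : ℝ)) * ∑ i ∈ B, f i (x + α • s))
            ((1 / (B.card : ℝ)) * ∑ i ∈ B, f i x))) :
    (1 / (B.card : ℝ)) * ∑ i ∈ B, f i y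
      ≤ (1 / (B.card : ℝ)) * ∑ i ∈ B, f i x
        - α * |⟪(1 / (B.card : ℝ)) • ∑ i ∈ B, gradient (f i) x, s⟫|
        + (((1 / (B.card : ℝ)) * ∑ i ∈ B, L i) / 2) * α ^ 2 * ‖s‖ ^ 2 := by
  have hmean (v : EuclideanSpace ℝ (Fin d)) :
      (1 / (B.card : ℝ)) * ∑ i ∈ B, f i (x + v)
        ≤ (1 / (B.card : ℝ)) * ∑ i ∈ B, f i x
          + ⟪(1 / (B.card : ℝ)) • ∑ i ∈ B, gradient (f i) x, v⟫
          + ((1 / (B.card : ℝ)) * ∑ i ∈ B, L i) / 2 * ‖v‖ ^ 2 := by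
    have hsum := Finset.sum_le_sum fun i (_ : i ∈ B) =>
      le_add_inner_gradient_add_sq (hdiff i) (hlip i) x v
    rw [Finset.sum_add_distrib, Finset.sum_add_distrib, ← sum_inner, ← Finset.sum_mul,
      ← Finset.sum_div] at hsum
    have hscaled := mul_le_mul_of_nonneg_left hsum (by positivity : 0 ≤ 1 / (B.card : ℝ))
    rw [real_inner_smul_left]
    linarith
  have hminus := hmean (-(α • s))
  have hplus := hmean (α • s)
  rw [← sub_eq_add_neg, inner_neg_right, norm_neg] at hminus
  rw [real_inner_smul_right, norm_smul, mul_pow, Real.norm_eq_abs, sq_abs] at hminus hplus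
  obtain ⟨hy_minus, hy_rest⟩ := le_min_iff.1 hy
  have hy_plus := hy_rest.trans (min_le_left _ _)
  rcases abs_cases ⟪(1 / (B.card : ℝ)) • ∑ i ∈ B, gradient (f i) x, s⟫ with h | h <;>
    rw [h.1] <;> linarith
end

section
/- (Deterministic form of the nonconvex complexity theorem for MiSTP.) Let L, μ, ε > 0 and σ ≥ 0 with σ < (με)² / (2L), and let α satisfy (με − √((με)² − 2Lσ))/L < α < (με + √((με)² − 2Lσ))/L. Let θ, g : ℕ → ℝ and f_* ∈ ℝ be such that for all k: θ_{k+1} ≤ θ_k − μ α g_k + (L/2) α² + σ and θ_k ≥ f_*. Then for any natural number K with (K + 1) · (μ ε α − (L/2) α² − σ) ≥ θ_0 − f_*, there exists k with 0 ≤ k ≤ K such that g_k ≤ ε. -/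
/-- A sequence that drops by more than `c` at each of the first `n + 1` steps has dropped by more
than `(n + 1) * c` in total. -/
theorem lt_sub_mul_of_forall_lt_sub {θ : ℕ → ℝ} {c : ℝ} {n : ℕ}
    (h : ∀ k ≤ n, θ (k + 1) < θ k - c) : θ (n + 1) < θ 0 - ((n : ℝ) + 1) * c := by
  induction n with
  | zero => simpa using h 0 le_rfl
  | succ n ih =>
    have h₁ := ih fun k hk => h k (by omega)
    have h₂ := h (n + 1) le_rfl
    push_cast
    linarith

theorem mistp_nonconvex_complexity (L μ ε : ℝ) (σ : ℝ)
    (hL : 0 < L) (hμ : 0 < μ) (hε : 0 < ε) (hσ : 0 ≤ σ)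
    (hσsmall : σ < (μ * ε) ^ 2 / (2 * L)) (α : ℝ)
    (hαlow : (μ * ε - Real.sqrt ((μ * ε) ^ 2 - 2 * L * σ)) / L < α)
    (hαhigh : α < (μ * ε + Real.sqrt ((μ * ε) ^ 2 - 2 * L * σ)) / L)
    (θ g : ℕ → ℝ) (f_star : ℝ)
    (hrec : ∀ k, θ (k + 1) ≤ θ k - μ * α * g k + (L / 2) * α ^ 2 + σ)
    (hbound : ∀ k, f_star ≤ θ k)
    (K : ℕ) (hK : θ 0 - f_star ≤ ((K : ℝ) + 1) * (μ * ε * α - (L / 2) * α ^ 2 - σ)) :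
    ∃ k ≤ K, g k ≤ ε := by
  have hsqrt : Real.sqrt ((μ * ε) ^ 2 - 2 * L * σ) ≤ μ * ε :=
    Real.sqrt_le_iff.mpr ⟨by positivity, sub_le_self _ (by positivity)⟩
  have hα : 0 < α := (div_nonneg (sub_nonneg.mpr hsqrt) hL.le).trans_lt hαlow
  by_contra! hg
  have hdrop := lt_sub_mul_of_forall_lt_sub (θ := θ) (n := K)
    (c := μ * ε * α - (L / 2) * α ^ 2 - σ) fun k hk => by
      have := mul_lt_mul_of_pos_left (hg k hk) (mul_pos hμ hα)
      linarith [hrec k]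
  linarith [hbound (K + 1)]
end

section
/- (Deterministic form of the convex complexity theorem for MiSTP.) Let L, μ, ε, R₀ > 0 and σ ≥ 0 satisfy σ < (με)² / (4 L R₀²). Set α = ε μ / (L R₀) and δ = 1 − μ α / R₀, and assume 0 < δ < 1. Let r : ℕ → ℝ satisfy r_0 > 0 and r_{k+1} ≤ δ r_k + (L/2) α² + σ for all k. Then for every natural number K with K ≥ (L R₀² / (μ² ε)) · log(4 r_0 / ε), one has r_K ≤ ε. -/
/-- A sequence contracting by `1 - t` up to an error `t * c` approaches `c` geometrically. -/
theorem le_add_pow_mul_of_contraction {t c : ℝ} (ht : t ≤ 1) (r : ℕ → ℝ)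
    (hrec : ∀ k, r (k + 1) ≤ (1 - t) * r k + t * c) (k : ℕ) :
    r k ≤ c + (1 - t) ^ k * (r 0 - c) := by
  induction k with
  | zero => simp
  | succ k ih =>
    calc r (k + 1) ≤ (1 - t) * r k + t * c := hrec k
      _ ≤ (1 - t) * (c + (1 - t) ^ k * (r 0 - c)) + t * c := by
        gcongr
      _ = c + (1 - t) ^ (k + 1) * (r 0 - c) := by ring

/-- After `log (a / b) / t` steps, geometric decay at rate `1 - t` brings `a` below `b`. -/
theorem one_sub_pow_mul_le_of_log_le {t a b : ℝ} (ht : t ≤ 1) (ha : 0 < a) (hb : 0 < b) (K : ℕ)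
    (hK : Real.log (a / b) ≤ t * K) : (1 - t) ^ K * a ≤ b := by
  have h₁ : (1 - t) ^ K ≤ Real.exp (-(t * K)) := by
    calc (1 - t) ^ K ≤ Real.exp (-t) ^ K :=
          pow_le_pow_left₀ (by linarith) (Real.one_sub_le_exp_neg t) K
      _ = Real.exp (-(t * K)) := by
        rw [← Real.exp_nat_mul]
        congr 1
        ring
  have h₂ : Real.exp (-(t * K)) ≤ b / a := by
    rw [← Real.le_log_iff_exp_le (div_pos hb ha), ← inv_div a b, Real.log_inv]
    linarith
  exact (le_div_iff₀ ha).mp (h₁.trans h₂)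

theorem mistp_convex_complexity (L μ ε R₀ σ : ℝ)
    (hL : 0 < L) (hμ : 0 < μ) (hε : 0 < ε) (hR₀ : 0 < R₀) (hσ : 0 ≤ σ)
    (hσsmall : σ < (μ * ε) ^ 2 / (4 * L * R₀ ^ 2))
    (α δ : ℝ) (hα : α = ε * μ / (L * R₀)) (hδ : δ = 1 - μ * α / R₀)
    (hδ0 : 0 < δ) (hδ1 : δ < 1)
    (r : ℕ → ℝ) (hr0 : 0 < r 0)
    (hrec : ∀ k, r (k + 1) ≤ δ * r k + (L / 2) * α ^ 2 + σ) :
    ∀ K : ℕ, (L * R₀ ^ 2 / (μ ^ 2 * ε)) * Real.log (4 * r 0 / ε) ≤ (K : ℝ) →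
      r K ≤ ε := by
  intro K hK
  obtain ⟨t, ht⟩ : ∃ t, t = μ ^ 2 * ε / (L * R₀ ^ 2) := ⟨_, rfl⟩
  have ht0 : 0 < t := by rw [ht]; positivity
  have hδt : δ = 1 - t := by
    rw [hδ, hα, ht]
    field_simp
  have hαt : (L / 2) * α ^ 2 = t * ε / 2 := by
    rw [hα, ht]
    field_simp
  have hσt : (μ * ε) ^ 2 / (4 * L * R₀ ^ 2) = t * ε / 4 := by
    rw [ht]
    field_simp
  have ht1 : t ≤ 1 := by linarith
  have hlog : Real.log (r 0 / (ε / 4)) ≤ t * K := by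
    rw [← inv_div (μ ^ 2 * ε), ← ht, inv_mul_le_iff₀ ht0] at hK
    rwa [div_div_eq_mul_div, mul_comm (r 0)]
  have hcontr := le_add_pow_mul_of_contraction (c := 3 * ε / 4) ht1 r (fun k => by
    have h := hrec k
    rw [hαt, hδt] at h
    linarith) K
  have hdecay := one_sub_pow_mul_le_of_log_le ht1 hr0 (by positivity) K hlog
  have hpow : 0 ≤ (1 - t) ^ K * (3 * ε / 4) := by
    have : 0 ≤ 1 - t := by linarith
    positivity
  linarith
end
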